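/- In the smooth solution setting for the approximated TV Wasserstein gradient flow on the torus (with parameters T > 0, ε ≥ 0, c ≥ 0), let α > c and suppose ρ(0, x) ≥ α for every x ∈ ℝᵈ. Then ρ(t, x) ≥ α for every t ∈ [0, T] and every x ∈ ℝᵈ. -/

import Mathlib

open MeasureTheory
open scoped RealInnerProductSpace

noncomputable section

/-- The fundamental domain `[0,1)^d` of the torus, inside `ℝ^d`. -/
def UnitCube (d : ℕ) : Set (EuclideanSpace ℝ (Fin d)) :=
  {x | ∀ i, 0 ≤ x i ∧ x i < 1}

/-- A function on `ℝ^d` is `ℤ^d`-periodic if it is invariant under translations by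
integer vectors. -/
def ZdPeriodic {d : ℕ} {V : Type*} (f : EuclideanSpace ℝ (Fin d) → V) : Prop :=
  ∀ (x : EuclideanSpace ℝ (Fin d)) (m : Fin d → ℤ),
    f (x + (EuclideanSpace.equiv (Fin d) ℝ).symm (fun i => (m i : ℝ))) = f x

/-- The divergence of a vector field on `ℝ^d`. -/
noncomputable def diverg {d : ℕ}
    (z : EuclideanSpace ℝ (Fin d) → EuclideanSpace ℝ (Fin d))
    (x : EuclideanSpace ℝ (Fin d)) : ℝ :=
  ∑ i, fderiv ℝ z x (EuclideanSpace.single i 1) i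


open Set Filter Topology

abbrev EE (d : ℕ) := EuclideanSpace ℝ (Fin d)

def pd {d : ℕ} (i : Fin d) (f : EE d → ℝ) (x : EE d) : ℝ :=
  fderiv ℝ f x (EuclideanSpace.single i 1)

abbrev Sm {d : ℕ} (f : EE d → ℝ) : Prop := ContDiff ℝ (⊤ : ℕ∞) f

lemma Sm.pd {d : ℕ} {f : EE d → ℝ} (hf : Sm f) (i : Fin d) : Sm (pd i f) := by
  have : ContDiff ℝ (⊤ : ℕ∞) (fderiv ℝ f) := hf.fderiv_right (by simp)
  exact this.clm_apply contDiff_const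

lemma Sm.diff {d : ℕ} {f : EE d → ℝ} (hf : Sm f) : Differentiable ℝ f :=
  hf.differentiable (by simp)

lemma per_pd {d : ℕ} {f : EE d → ℝ} (hf : ZdPeriodic f) (i : Fin d) : ZdPeriodic (pd i f) := by
  intro x m
  have h : (fun y => f (y + (EuclideanSpace.equiv (Fin d) ℝ).symm (fun i => (m i : ℝ)))) = f := by
    funext y; exact hf y m
  unfold pd
  conv_rhs => rw [← h]
  rw [fderiv_comp_add_right]

lemma pd_mul {d : ℕ} {f g : EE d → ℝ} (hf : Sm f) (hg : Sm g) (i : Fin d) (x : EE d) :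
    pd i (fun y => f y * g y) x = pd i f x * g x + f x * pd i g x := by
  unfold pd
  rw [fderiv_fun_mul (hf.diff x) (hg.diff x)]
  simp; ring

lemma pd_sub {d : ℕ} {f g : EE d → ℝ} (hf : Sm f) (hg : Sm g) (i : Fin d) (x : EE d) :
    pd i (fun y => f y - g y) x = pd i f x - pd i g x := by
  unfold pd
  rw [fderiv_fun_sub (hf.diff x) (hg.diff x)]
  simp

lemma pd_add {d : ℕ} {f g : EE d → ℝ} (hf : Sm f) (hg : Sm g) (i : Fin d) (x : EE d) :
    pd i (fun y => f y + g y) x = pd i f x + pd i g x := by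
  unfold pd
  rw [fderiv_fun_add (hf.diff x) (hg.diff x)]
  simp

lemma pd_sum {d : ℕ} {f : Fin d → EE d → ℝ} (hf : ∀ j, Sm (f j)) (i : Fin d) (x : EE d) :
    pd i (fun y => ∑ j, f j y) x = ∑ j, pd i (f j) x := by
  unfold pd
  rw [fderiv_fun_sum (fun j _ => (hf j).diff x)]
  simp

lemma pd_comp {d : ℕ} {f : EE d → ℝ} (hf : Sm f) {k : ℝ → ℝ} {k' : ℝ} (x : EE d)
    (hk : HasDerivAt k k' (f x)) (i : Fin d) :
    pd i (fun y => k (f y)) x = k' * pd i f x := by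
  unfold pd
  have := (hk.comp_hasFDerivAt x (hf.diff x).hasFDerivAt).fderiv
  change fderiv ℝ (k ∘ f) x _ = _
  rw [this]; simp

lemma pd_comm {d : ℕ} {f : EE d → ℝ} (hf : Sm f) (i j : Fin d) (x : EE d) :
    pd i (pd j f) x = pd j (pd i f) x := by
  have hd : Differentiable ℝ (fderiv ℝ f) :=
    (hf.fderiv_right (m := (⊤ : ℕ∞)) (by simp)).differentiable (by simp)
  have key : ∀ v w : EE d, fderiv ℝ (fun y => fderiv ℝ f y v) x w
      = fderiv ℝ (fderiv ℝ f) x w v := by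
    intro v w
    rw [fderiv_clm_apply (hd x) (differentiableAt_const v)]
    simp
  unfold pd
  rw [key, key]
  exact (hf.contDiffAt.isSymmSndFDerivAt (by simp only [minSmoothness_of_isRCLikeNormedField]; exact WithTop.coe_le_coe.2 le_top)) _ _

lemma grad_apply {d : ℕ} (f : EE d → ℝ) (x : EE d) (i : Fin d) : gradient f x i = pd i f x := by
  have : ⟪gradient f x, EuclideanSpace.single i (1:ℝ)⟫ = pd i f x := by
    unfold gradient pd; rw [InnerProductSpace.toDual_symm_apply]
  rw [← this, EuclideanSpace.inner_single_right]; simp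

lemma comp_pd {d : ℕ} {z : EE d → EE d} (hz : Differentiable ℝ z) (x : EE d) (i j : Fin d) :
    (fderiv ℝ z x (EuclideanSpace.single j 1)) i = pd j (fun y => z y i) x := by
  unfold pd
  have h := ((EuclideanSpace.proj (𝕜 := ℝ) (ι := Fin d) i :
    EE d →L[ℝ] ℝ).hasFDerivAt.comp x (hz x).hasFDerivAt).fderiv
  change _ = fderiv ℝ ((EuclideanSpace.proj (𝕜 := ℝ) (ι := Fin d) i : EE d →L[ℝ] ℝ) ∘ z) x _
  rw [h]; rfl

lemma diverg_eq {d : ℕ} {z : EE d → EE d} (hz : Differentiable ℝ z) (x : EE d) :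
    diverg z x = ∑ i, pd i (fun y => z y i) x :=
  Finset.sum_congr rfl fun i _ => comp_pd hz x i i

/-- closed cube -/
def KCube (d : ℕ) : Set (EE d) := {x | ∀ i, 0 ≤ x i ∧ x i ≤ 1}

lemma KCube_eq (d : ℕ) : KCube d = (WithLp.toLp 2) '' (Icc (0 : Fin d → ℝ) 1) := by
  ext x; constructor
  · intro h; exact ⟨x.ofLp, ⟨fun i => (h i).1, fun i => (h i).2⟩, rfl⟩
  · rintro ⟨y, hy, rfl⟩ i; exact ⟨hy.1 i, hy.2 i⟩

lemma KCube_compact (d : ℕ) : IsCompact (KCube d) := by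
  rw [KCube_eq]; exact isCompact_Icc.image (PiLp.continuous_toLp 2 _)

lemma Unit_sub (d : ℕ) : UnitCube d ⊆ KCube d := fun x hx i => ⟨(hx i).1, (hx i).2.le⟩

lemma Unit_pre (d : ℕ) : UnitCube d = (@WithLp.ofLp 2 (Fin d → ℝ)) ⁻¹' (pi univ fun _ => Ico 0 1) := by
  ext x; simp [UnitCube]

lemma Unit_meas (d : ℕ) : MeasurableSet (UnitCube d) := by
  rw [Unit_pre]
  exact (PiLp.volume_preserving_ofLp (Fin d)).measurable
    (MeasurableSet.univ_pi fun _ => measurableSet_Ico)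

lemma Unit_fin (d : ℕ) : volume (UnitCube d) < ⊤ :=
  (measure_mono (Unit_sub d)).trans_lt (KCube_compact d).measure_lt_top

lemma intOn {d : ℕ} {f : EE d → ℝ} (hf : Continuous f) : IntegrableOn f (UnitCube d) :=
  (hf.continuousOn.integrableOn_compact (KCube_compact d)).mono_set (Unit_sub d)

lemma int_unit {d : ℕ} (f : EE d → ℝ) :
    ∫ x in UnitCube d, f x = ∫ y in Icc (0 : Fin d → ℝ) 1, f (WithLp.toLp 2 y) := by
  have h := (PiLp.volume_preserving_ofLp (Fin d)).setIntegral_preimage_emb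
    (MeasurableEquiv.toLp 2 (Fin d → ℝ)).symm.measurableEmbedding
    (fun y => f (WithLp.toLp 2 y)) (pi univ fun _ => Ico 0 1)
  rw [← Unit_pre] at h
  simp only [WithLp.toLp_ofLp] at h
  rw [h]
  exact setIntegral_congr_set (Measure.univ_pi_Ico_ae_eq_Icc (f := fun _ => (0:ℝ)) (g := fun _ => (1:ℝ)))

lemma int_div {d : ℕ} (V : Fin d → EE d → ℝ) (hV : ∀ i, Sm (V i)) (hp : ∀ i, ZdPeriodic (V i)) :
    ∫ x in UnitCube d, ∑ i, pd i (V i) x = 0 := by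
  cases d with
  | zero => simp
  | succ n =>
    rw [int_unit]
    let L : (Fin (n+1) → ℝ) →L[ℝ] EE (n+1) := (EuclideanSpace.equiv (Fin (n+1)) ℝ).symm
    have hc : ∀ i, Continuous fun y : Fin (n+1) → ℝ => V i (L y) := fun i =>
      (hV i).continuous.comp L.continuous
    have hs : ∀ i, (EuclideanSpace.single i (1:ℝ)) = L (Pi.single i 1) := by
      intro i; ext j; simp [L, EuclideanSpace.equiv]
    have h := integral_divergence_of_hasFDerivAt_off_countable' (0 : Fin (n+1) → ℝ) 1
      (fun _ => zero_le_one) (fun i y => V i (L y))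
      (fun i y => (fderiv ℝ (V i) (L y)).comp L) ∅ countable_empty
      (fun i => (hc i).continuousOn)
      (fun x _ i => ((hV i).diff (L x)).hasFDerivAt.comp x L.hasFDerivAt)
      (by
        apply Continuous.integrableOn_Icc
        refine continuous_finsetSum _ fun i _ => ?_
        have := ((hV i).pd i).continuous.comp L.continuous
        simp only [ContinuousLinearMap.comp_apply, ← hs]
        exact this)
    simp only [ContinuousLinearMap.comp_apply, ← hs] at h
    refine h.trans (Finset.sum_eq_zero fun i _ => ?_)
    rw [sub_eq_zero]
    refine integral_congr_ae (Eventually.of_forall fun y => ?_)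
    have := hp i (L (Fin.insertNth i 0 y)) (Pi.single i 1)
    simp only [Pi.one_apply, Pi.zero_apply] 
    rw [← this]
    congr 1
    change _ = L _ + L _
    rw [← map_add]
    congr 1
    ext j
    rcases eq_or_ne j i with rfl | hj
    · simp
    · obtain ⟨k, rfl⟩ := Fin.exists_succAbove_eq hj
      simp

lemma zero_of_int {d : ℕ} {f : EE d → ℝ} (hf : Continuous f) (hp : ZdPeriodic f)
    (h0 : ∀ x, 0 ≤ f x) (hi : ∫ x in UnitCube d, f x ≤ 0) (x : EE d) : f x = 0 := by
  by_contra hne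
  have hpos : 0 < f x := lt_of_le_of_ne (h0 x) (Ne.symm hne)
  -- move into the cube
  obtain ⟨x0, hx0, hfx0⟩ : ∃ x0 ∈ UnitCube d, 0 < f x0 := by
    refine ⟨x + (EuclideanSpace.equiv (Fin d) ℝ).symm (fun i => ((-⌊x i⌋ : ℤ) : ℝ)), ?_, ?_⟩
    · intro i
      have e : (x + (EuclideanSpace.equiv (Fin d) ℝ).symm (fun i => ((-⌊x i⌋ : ℤ) : ℝ))) i
        = x i - ⌊x i⌋ := by simp [EuclideanSpace.equiv, sub_eq_add_neg]
      rw [e]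
      exact ⟨sub_nonneg.2 (Int.floor_le _), by linarith [Int.lt_floor_add_one (x i)]⟩
    · rw [hp]; exact hpos
  let w : EE d := WithLp.toLp 2 (fun _ => (1:ℝ)/2)
  have hlim : Tendsto (fun s : ℝ => f (x0 + s • (w - x0))) (𝓝[>] 0) (𝓝 (f x0)) := by
    have : Continuous (fun s : ℝ => f (x0 + s • (w - x0))) := by fun_prop
    simpa using (this.tendsto 0).mono_left nhdsWithin_le_nhds
  have hev := (hlim.eventually (lt_mem_nhds hfx0)).and
    (Ioo_mem_nhdsGT (show (0:ℝ) < 1 by norm_num))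
  obtain ⟨s, hs1, hs2⟩ := hev.exists
  let U : Set (EE d) := {y | ∀ i, 0 < y i ∧ y i < 1} ∩ {y | 0 < f y}
  have hU : IsOpen U := by
    refine IsOpen.inter ?_ (isOpen_lt continuous_const hf)
    have : {y : EE d | ∀ i, 0 < y i ∧ y i < 1} = ⋂ i, {y | 0 < y i ∧ y i < 1} := by ext; simp
    rw [this]
    refine isOpen_iInter_of_finite fun i => ?_
    have hci : Continuous fun y : EE d => y i := by fun_prop
    exact (isOpen_lt continuous_const hci).inter (isOpen_lt hci continuous_const)
  have hUne : U.Nonempty := by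
    refine ⟨x0 + s • (w - x0), fun i => ?_, hs1⟩
    have e : (x0 + s • (w - x0)) i = (1 - s) * x0 i + s * (1/2) := by simp [w]; ring
    rw [e]
    have := hx0 i
    constructor
    · nlinarith [hs2.1, hs2.2, mul_nonneg (sub_nonneg.2 hs2.2.le) this.1]
    · nlinarith [hs2.1, hs2.2, mul_nonneg (sub_nonneg.2 hs2.2.le) (sub_nonneg.2 this.2.le)]
  have hμ : 0 < volume U := hU.measure_pos volume hUne
  have : 0 < ∫ x in UnitCube d, f x := by
    rw [setIntegral_pos_iff_support_of_nonneg_ae (Eventually.of_forall h0) (intOn hf)]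
    refine hμ.trans_le (measure_mono ?_)
    rintro y ⟨h1, h2⟩
    exact ⟨ne_of_gt h2, fun i => ⟨(h1 i).1.le, (h1 i).2⟩⟩
  linarith

lemma mono_deriv {d : ℕ} {z P : EE d → EE d} (hz : Differentiable ℝ z) (hP : Differentiable ℝ P)
    (hm : ∀ x y, 0 ≤ ⟪z x - z y, P x - P y⟫) (x v : EE d) :
    0 ≤ ⟪fderiv ℝ z x v, fderiv ℝ P x v⟫ := by
  have line : ∀ {F : EE d → EE d}, Differentiable ℝ F →
      Tendsto (fun s : ℝ => s⁻¹ • (F (x + s • v) - F x)) (𝓝[≠] 0) (𝓝 (fderiv ℝ F x v)) := by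
    intro F hF
    have h := ((hF x).hasFDerivAt.hasLineDerivAt v)
    have h2 := hasDerivAt_iff_tendsto_slope_zero.1 h
    simpa using h2
  refine ge_of_tendsto ((line hz).inner (line hP)) ?_
  filter_upwards with s
  rw [real_inner_smul_left, real_inner_smul_right, ← mul_assoc]
  exact mul_nonneg (mul_self_nonneg _) (hm _ _)

lemma slice {d : ℕ} (ρ : EE d → ℝ) (z : EE d → EE d) (hρ : Sm ρ) (hz : ContDiff ℝ (⊤ : ℕ∞) z)
    (hρp : ZdPeriodic ρ) (hzp : ZdPeriodic z) (c ε : ℝ) (hc : 0 ≤ c) (hε : 0 ≤ ε)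
    (hρc : ∀ x, c < ρ x) (hz1 : ∀ x, ‖z x‖ ≤ 1)
    (hcomp : ∫ x in UnitCube d, ‖gradient ρ x‖ ≤ ∫ x in UnitCube d, ⟪z x, gradient ρ x⟫)
    (k : ℝ → ℝ) (hk : ContDiff ℝ (⊤ : ℕ∞) k) (hk' : ∀ s, 0 ≤ deriv k s) :
    0 ≤ ∫ x in UnitCube d, k (ρ x) * diverg (fun y => ρ y •
          gradient (fun w => diverg z w + ε / (ρ w - c) ^ 2) y) x := by
  have hzd : Differentiable ℝ z := hz.differentiable (by simp)
  have hzi : ∀ i, Sm (fun y => z y i) := fun i => contDiff_euclidean.1 hz i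
  have hzip : ∀ i, ZdPeriodic (fun y => z y i) := fun i x m => by
    simp only [hzp x m]
  have hDeq : diverg z = fun w => ∑ j, pd j (fun y => z y j) w := funext fun w => diverg_eq hzd w
  have hD : Sm (fun w => ∑ j, pd j (fun y => z y j) w) :=
    ContDiff.sum fun j _ => (hzi j).pd j
  have hDp : ZdPeriodic (fun w => ∑ j, pd j (fun y => z y j) w) := fun x m =>
    Finset.sum_congr rfl fun j _ => per_pd (hzip j) j x m
  have hG : Sm (fun w => ε / (ρ w - c) ^ 2) :=
    contDiff_const.div ((hρ.sub contDiff_const).pow 2)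
      (fun x => pow_ne_zero _ (sub_ne_zero.2 (hρc x).ne'))
  have hGp : ZdPeriodic (fun w => ε / (ρ w - c) ^ 2) := fun x m => by simp only [hρp x m]
  rw [hDeq]
  set u : EE d → ℝ := fun w => (∑ j, pd j (fun y => z y j) w) + ε / (ρ w - c) ^ 2 with hu
  have hus : Sm u := hD.add hG
  have hup : ZdPeriodic u := fun x m => by
    have h1 := hDp x m
    have h2 := hGp x m
    simp only [hu] at *
    rw [h1, h2]
  have hgs : ∀ {f : EE d → ℝ}, Sm f → ContDiff ℝ (⊤ : ℕ∞) (gradient f) := fun {f} hf => by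
    rw [contDiff_euclidean]; intro i
    simp only [grad_apply]; exact hf.pd i
  have hdiv : ∀ x, diverg (fun y => ρ y • gradient u y) x = ∑ i, pd i (fun y => ρ y * pd i u y) x := by
    intro x
    have hdd : Differentiable ℝ (fun y => ρ y • gradient u y) :=
      (hρ.smul (hgs hus)).differentiable (by simp)
    rw [diverg_eq hdd]
    simp [grad_apply]
  simp only [hdiv]
  -- the coefficient
  have hdk : ContDiff ℝ (⊤ : ℕ∞) (deriv k) := ((contDiff_infty_iff_deriv).1 hk).2
  let h : ℝ → ℝ := fun s => deriv k s * s
  have hh : ContDiff ℝ (⊤ : ℕ∞) h := hdk.mul contDiff_id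
  have hhd : Differentiable ℝ h := hh.differentiable (by simp)
  have hkd : Differentiable ℝ k := hk.differentiable (by simp)
  have ha : Sm (fun x => h (ρ x)) := hh.comp hρ
  have hkρ : Sm (fun x => k (ρ x)) := hk.comp hρ
  have ha0 : ∀ x, 0 ≤ h (ρ x) := fun x => mul_nonneg (hk' _) (hc.trans (hρc x).le)
  let p : Fin d → EE d → ℝ := fun i x => h (ρ x) * pd i ρ x
  have hp : ∀ i, Sm (p i) := fun i => ha.mul (hρ.pd i)
  have hpp : ∀ i, ZdPeriodic (p i) := fun i x m => by
    simp only [p]; rw [hρp x m, per_pd hρp i x m]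
  let V : Fin d → EE d → ℝ := fun i y =>
    k (ρ y) * (ρ y * pd i u y) - ∑ j, p j y * pd j (fun w => z w i) y
  have hV1 : ∀ i, Sm (fun y => k (ρ y) * (ρ y * pd i u y)) := fun i =>
    hkρ.mul (hρ.mul (hus.pd i))
  have hV2 : ∀ i j, Sm (fun y => p j y * pd j (fun w => z w i) y) := fun i j =>
    (hp j).mul ((hzi i).pd j)
  have hV3 : ∀ i, Sm (fun y => ∑ j, p j y * pd j (fun w => z w i) y) := fun i =>
    ContDiff.sum fun j _ => hV2 i j
  have hV : ∀ i, Sm (V i) := fun i => (hV1 i).sub (hV3 i)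
  have hVp : ∀ i, ZdPeriodic (V i) := fun i x m => by
    simp only [V]
    rw [hρp x m, per_pd hup i x m]
    congr 1
    refine Finset.sum_congr rfl fun j _ => ?_
    rw [hpp j x m, per_pd (hzip i) j x m]
  rw [← int_div V hV hVp]
  refine setIntegral_mono (intOn ?_) (intOn ?_) ?_
  · exact continuous_finsetSum _ fun i _ => ((hV i).pd i).continuous
  · have hs : ∀ i, Sm (fun y => ρ y * pd i u y) := fun i => hρ.mul (hus.pd i)
    exact hkρ.continuous.mul (continuous_finsetSum _ fun i _ => ((hs i).pd i).continuous)
  -- pointwise compatibility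
  have hgc : Continuous (gradient ρ) := (hgs hρ).continuous
  have hgp : ZdPeriodic (gradient ρ) := fun x m => by
    ext i; rw [grad_apply, grad_apply, per_pd hρp i x m]
  have hle : ∀ x y, ⟪z x, gradient ρ y⟫ ≤ ‖gradient ρ y‖ := fun x y =>
    (real_inner_le_norm _ _).trans (mul_le_of_le_one_left (norm_nonneg _) (hz1 x))
  have heq : ∀ x, ⟪z x, gradient ρ x⟫ = ‖gradient ρ x‖ := by
    intro x
    have := zero_of_int (f := fun x => ‖gradient ρ x‖ - ⟪z x, gradient ρ x⟫)
      (hgc.norm.sub (hz.continuous.inner hgc))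
      (fun x m => by simp only [hgp x m, hzp x m]) (fun x => sub_nonneg.2 (hle x x))
      (by
        rw [integral_sub (intOn hgc.norm) (intOn (hz.continuous.inner hgc))]
        linarith) x
    linarith
  let P : EE d → EE d := fun x => h (ρ x) • gradient ρ x
  have hP : ContDiff ℝ (⊤ : ℕ∞) P := ha.smul (hgs hρ)
  have hPd : Differentiable ℝ P := hP.differentiable (by simp)
  have hPi : ∀ i, (fun y => P y i) = p i := fun i => by
    funext y; simp [P, p, grad_apply]
  have hm : ∀ x y, 0 ≤ ⟪z x - z y, P x - P y⟫ := by
    intro x y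
    simp only [P, inner_sub_left, inner_sub_right, real_inner_smul_right]
    have h1 := mul_le_mul_of_nonneg_left (hle x y) (ha0 y)
    have h2 := mul_le_mul_of_nonneg_left (hle y x) (ha0 x)
    rw [heq x, heq y]
    linarith
  intro x
  have key : ∀ j, 0 ≤ ∑ i, pd j (fun y => z y i) x * pd j (p i) x := by
    intro j
    have := mono_deriv hzd hPd hm x (EuclideanSpace.single j 1)
    rw [PiLp.inner_apply] at this
    simp only [comp_pd hzd, comp_pd hPd, hPi] at this
    simpa [mul_comm] using this
  have psymm : ∀ i j, pd i (p j) x = pd j (p i) x := by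
    intro i j
    simp only [p]
    rw [pd_mul ha (hρ.pd j), pd_mul ha (hρ.pd i), pd_comp hρ x (hhd _).hasDerivAt,
      pd_comp hρ x (hhd _).hasDerivAt, pd_comm hρ i j]
    ring
  have hpu : ∀ i, pd i u x = (∑ j, pd i (pd j (fun y => z y j)) x)
      + (-2 * ε / (ρ x - c) ^ 3) * pd i ρ x := by
    intro i
    have hne : ρ x - c ≠ 0 := sub_ne_zero.2 (hρc x).ne'
    have hd : HasDerivAt (fun s => ε / (s - c) ^ 2) (-2 * ε / (ρ x - c) ^ 3) (ρ x) := by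
      have := ((((hasDerivAt_id (ρ x)).sub_const c).pow 2).inv (pow_ne_zero 2 hne)).const_mul ε
      refine (this.congr_deriv ?_).congr_of_eventuallyEq
        (Eventually.of_forall fun s => ?_)
      · simp only [id_eq, Pi.pow_apply, Nat.cast_ofNat]
        field_simp
        norm_num
      · simp [div_eq_mul_inv]
    rw [hu, pd_add hD hG, pd_sum (fun j => (hzi j).pd j), pd_comp hρ x hd]
  have e1 : ∀ i, pd i (V i) x = (deriv k (ρ x) * pd i ρ x) * (ρ x * pd i u x)
      + k (ρ x) * pd i (fun y => ρ y * pd i u y) x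
      - ∑ j, (pd i (p j) x * pd j (fun w => z w i) x
        + p j x * pd i (pd j (fun w => z w i)) x) := by
    intro i
    simp only [V]
    rw [pd_sub (hV1 i) (hV3 i), pd_sum (hV2 i), pd_mul hkρ (hρ.mul (hus.pd i)),
      pd_comp hρ x (hkd _).hasDerivAt]
    congr 1
    exact Finset.sum_congr rfl fun j _ => pd_mul (hp j) ((hzi i).pd j) i x
  simp only [e1, Finset.sum_sub_distrib, Finset.sum_add_distrib, Finset.mul_sum]
  have s1 : ∑ i, ∑ j, pd i (p j) x * pd j (fun w => z w i) x
      = ∑ j, ∑ i, pd j (fun y => z y i) x * pd j (p i) x := by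
    rw [Finset.sum_comm]
    refine Finset.sum_congr rfl fun j _ => Finset.sum_congr rfl fun i _ => ?_
    rw [psymm, mul_comm]
  have s2 : 0 ≤ ∑ j, ∑ i, pd j (fun y => z y i) x * pd j (p i) x :=
    Finset.sum_nonneg fun j _ => key j
  have s3 : ∑ i, ∑ j, p j x * pd i (pd j (fun w => z w i)) x
      = ∑ i, p i x * ∑ j, pd i (pd j (fun y => z y j)) x := by
    rw [Finset.sum_comm]
    refine Finset.sum_congr rfl fun j _ => ?_
    rw [Finset.mul_sum]
    refine Finset.sum_congr rfl fun i _ => ?_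
    rw [pd_comm (hzi i)]
  have s4 : ∑ i, (deriv k (ρ x) * pd i ρ x) * (ρ x * pd i u x)
      ≤ ∑ i, p i x * ∑ j, pd i (pd j (fun y => z y j)) x := by
    refine Finset.sum_le_sum fun i _ => ?_
    rw [hpu]
    simp only [p, h]
    have hq : 0 ≤ 2 * ε / (ρ x - c) ^ 3 :=
      div_nonneg (by positivity) (pow_nonneg (sub_nonneg.2 (hρc x).le) 3)
    have hq2 := mul_nonneg (mul_nonneg (ha0 x) hq) (mul_self_nonneg (pd i ρ x))
    simp only [h] at hq2
    have : -2 * ε / (ρ x - c) ^ 3 = - (2 * ε / (ρ x - c) ^ 3) := by ring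
    rw [this]
    nlinarith [hq2]
  linarith

lemma exists_phi (α : ℝ) : ∃ φ k : ℝ → ℝ, ContDiff ℝ (⊤ : ℕ∞) k ∧ (∀ s, 0 ≤ deriv k s) ∧
    (∀ s, HasDerivAt φ (k s) s) ∧ (∀ s, α ≤ s → φ s = 0) ∧ (∀ s, s < α → 0 < φ s) := by
  have hk : ContDiff ℝ (⊤ : ℕ∞) (fun s : ℝ => -expNegInvGlue (α - s)) :=
    (expNegInvGlue.contDiff.comp (contDiff_const.sub contDiff_id)).neg
  refine ⟨fun s => ∫ r in α..s, -expNegInvGlue (α - r), fun s => -expNegInvGlue (α - s), hk,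
    ?_, ?_, ?_, ?_⟩
  · intro s
    refine Monotone.deriv_nonneg ?_
    intro a b hab
    exact neg_le_neg (expNegInvGlue.monotone (by linarith))
  · intro s
    exact (hk.continuous.integral_hasStrictDerivAt α s).hasDerivAt
  · intro s hs
    simp only
    rw [intervalIntegral.integral_congr (g := fun _ => (0:ℝ))]
    · simp
    · intro r hr
      rw [uIcc_of_le hs] at hr
      simp only [neg_eq_zero]
      exact expNegInvGlue.zero_of_nonpos (by linarith [hr.1])
  · intro s hs
    simp only
    rw [intervalIntegral.integral_symm, intervalIntegral.integral_neg, neg_neg]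
    refine intervalIntegral.intervalIntegral_pos_of_pos_on ?_ ?_ hs
    · have hc : Continuous fun x : ℝ => expNegInvGlue (α - x) := by
        simpa only [neg_neg] using hk.continuous.fun_neg
      exact hc.intervalIntegrable s α
    · intro r hr
      exact expNegInvGlue.pos_of_pos (by linarith [hr.2])

/-- minimum principle, Theorem 3.1 in the smooth setting: in the
smooth solution setting for the approximated TV Wasserstein gradient flow
`∂ₜρ + div(ρ ∇(div z - f'(ρ))) = 0` (with `f(s) = ε/(s-c)`, so `-f'(ρ) = ε/(ρ-c)²`),
any lower bound `α > c` on the initial density propagates in time. -/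
theorem minimum_principle (d : ℕ) (hd : 1 ≤ d) (T ε c : ℝ)
    (hT : 0 < T) (hε : 0 ≤ ε) (hc : 0 ≤ c)
    (ρ : ℝ → EuclideanSpace ℝ (Fin d) → ℝ)
    (z : ℝ → EuclideanSpace ℝ (Fin d) → EuclideanSpace ℝ (Fin d))
    (hρsm : ContDiffOn ℝ (⊤ : ℕ∞) (fun p : ℝ × EuclideanSpace ℝ (Fin d) => ρ p.1 p.2)
      (Set.Icc 0 T ×ˢ Set.univ))
    (hzsm : ContDiffOn ℝ (⊤ : ℕ∞) (fun p : ℝ × EuclideanSpace ℝ (Fin d) => z p.1 p.2)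
      (Set.Icc 0 T ×ˢ Set.univ))
    (hρper : ∀ t ∈ Set.Icc (0 : ℝ) T, ZdPeriodic (ρ t))
    (hzper : ∀ t ∈ Set.Icc (0 : ℝ) T, ZdPeriodic (z t))
    (hρc : ∀ t ∈ Set.Icc (0 : ℝ) T, ∀ x, c < ρ t x)
    (hz1 : ∀ t ∈ Set.Icc (0 : ℝ) T, ∀ x, ‖z t x‖ ≤ 1)
    (hcomp : ∀ t ∈ Set.Icc (0 : ℝ) T,
      ∫ x in UnitCube d, ‖gradient (ρ t) x‖ ≤
        ∫ x in UnitCube d, ⟪z t x, gradient (ρ t) x⟫)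
    (hpde : ∀ t ∈ Set.Icc (0 : ℝ) T, ∀ x,
      deriv (fun s => ρ s x) t +
        diverg (fun y => ρ t y •
          gradient (fun w => diverg (z t) w + ε / (ρ t w - c) ^ 2) y) x = 0)
    (α : ℝ) (hα : c < α) (h0 : ∀ x, α ≤ ρ 0 x) :
    ∀ t ∈ Set.Icc (0 : ℝ) T, ∀ x, α ≤ ρ t x := by
  obtain ⟨φ, k, hk, hk', hφ, hφ0, hφ1⟩ := exists_phi α
  have hφn : ∀ s, 0 ≤ φ s := fun s => by
    rcases le_or_gt α s with h | h
    · exact (hφ0 s h).ge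
    · exact (hφ1 s h).le
  have hφc : Continuous φ := continuous_iff_continuousAt.2 fun s => (hφ s).continuousAt
  have hρs : ∀ t ∈ Icc (0:ℝ) T, Sm (ρ t) := fun t ht => by
    rw [Sm, ← contDiffOn_univ]
    exact hρsm.comp (contDiff_prodMk_right t).contDiffOn (fun x _ => ⟨ht, mem_univ _⟩)
  have hzs : ∀ t ∈ Icc (0:ℝ) T, ContDiff ℝ (⊤ : ℕ∞) (z t) := fun t ht => by
    rw [← contDiffOn_univ]
    exact hzsm.comp (contDiff_prodMk_right t).contDiffOn (fun x _ => ⟨ht, mem_univ _⟩)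
  set R : ℝ × EE d → ℝ := fun p => ρ p.1 p.2 with hR
  have hRc : ContinuousOn R (Icc 0 T ×ˢ univ) := hρsm.continuousOn
  let I : ℝ → ℝ := fun t => ∫ x in UnitCube d, φ (ρ t x)
  have hIc : ContinuousOn I (Icc 0 T) := by
    have hc1 : ContinuousOn (fun p => φ (R p)) (Icc 0 T ×ˢ univ) := hφc.comp_continuousOn hRc
    obtain ⟨C, hC⟩ := (isCompact_Icc.prod (KCube_compact d)).exists_bound_of_continuousOn
      (hc1.mono (prod_mono_right (subset_univ _)))
    refine continuousOn_of_dominated (bound := fun _ => C) ?_ ?_ ?_ ?_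
    · intro t ht
      exact (hφc.comp (hρs t ht).continuous).aestronglyMeasurable
    · intro t ht
      filter_upwards [ae_restrict_mem (Unit_meas d)] with x hx
      exact hC (t, x) ⟨ht, Unit_sub d hx⟩
    · exact integrableOn_const (Unit_fin d).ne
    · refine Eventually.of_forall fun x => ?_
      exact hc1.comp (f := fun t : ℝ => (t, x)) (by fun_prop) (fun t ht => ⟨ht, mem_univ _⟩)
  have hO : IsOpen (Ioo (0:ℝ) T ×ˢ (univ : Set (EE d))) := isOpen_Ioo.prod isOpen_univ
  have hρo : ContDiffOn ℝ (⊤ : ℕ∞) R (Ioo 0 T ×ˢ univ) :=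
    hρsm.mono (prod_mono_left Ioo_subset_Icc_self)
  have hfd : ContinuousOn (fderiv ℝ R) (Ioo 0 T ×ˢ univ) :=
    hρo.continuousOn_fderiv_of_isOpen hO (by exact WithTop.coe_le_coe.2 le_top)
  let F' : ℝ → EE d → ℝ := fun s x => k (ρ s x) * fderiv ℝ R (s, x) (1, 0)
  have hF'c : ContinuousOn (fun p : ℝ × EE d => F' p.1 p.2) (Ioo 0 T ×ˢ univ) :=
    (hk.continuous.comp_continuousOn hρo.continuousOn).mul (hfd.clm_apply continuousOn_const)
  have hder : ∀ s ∈ Ioo (0:ℝ) T, ∀ x, HasDerivAt (fun s => ρ s x) (fderiv ℝ R (s, x) (1, 0)) s := by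
    intro s hs x
    have h1 : DifferentiableAt ℝ R (s, x) :=
      (hρo.differentiableOn (by simp)).differentiableAt (hO.mem_nhds ⟨hs, mem_univ _⟩)
    exact h1.hasFDerivAt.comp_hasDerivAt s ((hasDerivAt_id s).prodMk (hasDerivAt_const s x))
  have hId : ∀ t ∈ Ioo (0:ℝ) T, HasDerivAt I (∫ x in UnitCube d, F' t x) t := by
    intro t ht
    obtain ⟨δ, hδ, hsub⟩ := Metric.nhds_basis_closedBall.mem_iff.1 (isOpen_Ioo.mem_nhds ht)
    obtain ⟨C, hC⟩ := ((isCompact_closedBall t δ).prod (KCube_compact d)).exists_bound_of_continuousOn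
      (hF'c.mono (prod_mono hsub (subset_univ _)))
    refine (hasDerivAt_integral_of_dominated_loc_of_deriv_le (F := fun s x => φ (ρ s x))
      (F' := F') (bound := fun _ => C)
      (Metric.closedBall_mem_nhds t hδ) ?_ ?_ ?_ ?_ ?_ ?_).2
    · filter_upwards [isOpen_Ioo.mem_nhds ht] with s hs
      exact (hφc.comp (hρs s (Ioo_subset_Icc_self hs)).continuous).aestronglyMeasurable
    · exact intOn (hφc.comp (hρs t (Ioo_subset_Icc_self ht)).continuous)
    · have : Continuous (F' t) := by
        rw [← continuousOn_univ]
        exact hF'c.comp (f := fun x : EE d => (t, x)) (by fun_prop) (fun x _ => ⟨ht, mem_univ _⟩)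
      exact this.aestronglyMeasurable
    · filter_upwards [ae_restrict_mem (Unit_meas d)] with x hx s hs
      exact hC (s, x) ⟨hs, Unit_sub d hx⟩
    · exact integrableOn_const (Unit_fin d).ne
    · refine Eventually.of_forall fun x s hs => ?_
      exact (hφ (ρ s x)).comp s (hder s (hsub hs) x)
  have hanti : AntitoneOn I (Icc 0 T) := by
    refine antitoneOn_of_deriv_nonpos (convex_Icc 0 T) hIc ?_ ?_
    · rw [interior_Icc]
      exact fun t ht => (hId t ht).differentiableAt.differentiableWithinAt
    · rw [interior_Icc]
      intro t ht
      have ht' := Ioo_subset_Icc_self ht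
      rw [(hId t ht).deriv]
      have hs := slice (ρ t) (z t) (hρs t ht') (hzs t ht') (hρper t ht') (hzper t ht') c ε hc hε
        (hρc t ht') (hz1 t ht') (hcomp t ht') k hk hk'
      have e : ∀ x, F' t x = -(k (ρ t x) * diverg (fun y => ρ t y •
          gradient (fun w => diverg (z t) w + ε / (ρ t w - c) ^ 2) y) x) := by
        intro x
        have h1 := hpde t ht' x
        rw [(hder t ht x).deriv] at h1
        simp only [F']
        rw [eq_neg_of_add_eq_zero_left h1]
        ring
      simp only [e]
      rw [integral_neg]
      linarith
  intro t ht x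
  have h00 : (0:ℝ) ∈ Icc 0 T := ⟨le_rfl, hT.le⟩
  have hI0 : I 0 = 0 := by
    simp only [I, hφ0 _ (h0 _), integral_zero]
  have hIt : I t ≤ 0 := hI0 ▸ hanti h00 ht ht.1
  have := zero_of_int (f := fun x => φ (ρ t x)) (hφc.comp (hρs t ht).continuous)
    (fun x m => by simp only [hρper t ht x m]) (fun x => hφn _) hIt x
  by_contra hlt
  exact (hφ1 _ (not_le.1 hlt)).ne' this

end
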